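/- arXiv:1709.04072 — 10 statements merged into one kernel-verified Lean document; each statement's English description precedes it below -/
import Mathlib

section
/- Let E be a real inner product space, F : E → ℝ, and let (x^k)_{k≥0}, (ω^k)_{k≥0} be sequences in E. Let a, b > 0, θ > 1, and let (η_k)_{k≥0} be a nonnegative real sequence with ∑_k η_k < +∞ (hence ∑_k η_k² < +∞). Suppose the pseudo sufficient descent condition holds: F(x^k) − F(x^{k+1}) ≥ a‖ω^{k+1} − ω^k‖² − b η_k² for all k. Define t_k := (θ·b·∑_{l=k}^{∞} η_l²)^{1/θ} and ξ_k := F(x^k) + t_k^θ/θ. Then for every k, ξ_k − ξ_{k+1} ≥ a‖ω^k − ω^{k+1}‖²; in fact ξ_k − ξ_{k+1} = F(x^k) − F(x^{k+1}) + b η_k². -/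
open Filter Topology

/-- Pseudo sufficient descent transfers to the Lyapunov sequence
    ξ_k = F(x^k) + t_k^θ/θ, where t_k = (θ·b·∑_{l=k}^∞ η_l²)^{1/θ}. -/
theorem lyapunov_descent {E : Type*} [NormedAddCommGroup E] [InnerProductSpace ℝ E]
    (F : E → ℝ) (x ω : ℕ → E) (a b θ : ℝ) (η : ℕ → ℝ)
    (ha : 0 < a) (hb : 0 < b) (hθ : 1 < θ)
    (hη : ∀ k, 0 ≤ η k) (hsum : Summable η)
    (hdesc : ∀ k, F (x k) - F (x (k + 1)) ≥ a * ‖ω (k + 1) - ω k‖ ^ 2 - b * (η k) ^ 2)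
    (t : ℕ → ℝ) (ht : ∀ k, t k = (θ * b * ∑' l : ℕ, (η (k + l)) ^ 2) ^ (1 / θ))
    (ξ : ℕ → ℝ) (hξ : ∀ k, ξ k = F (x k) + (t k) ^ θ / θ) :
    ∀ k, ξ k - ξ (k + 1) = F (x k) - F (x (k + 1)) + b * (η k) ^ 2 ∧
      ξ k - ξ (k + 1) ≥ a * ‖ω k - ω (k + 1)‖ ^ 2 := by
  have hθ0 : 0 < θ := by linarith
  have hsq : Summable (fun l => (η l) ^ 2) := by
    refine Summable.of_nonneg_of_le (fun l => sq_nonneg _) (fun l => ?_)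
      (hsum.mul_left (∑' i, η i))
    have h1 : η l ≤ ∑' i, η i := hsum.le_tsum l (fun j _ => hη j)
    rw [sq]
    exact mul_le_mul_of_nonneg_right h1 (hη l)
  have htp : ∀ k, (t k) ^ θ / θ = b * ∑' l : ℕ, (η (k + l)) ^ 2 := by
    intro k
    have h0 : 0 ≤ ∑' l : ℕ, (η (k + l)) ^ 2 := tsum_nonneg (fun l => sq_nonneg _)
    have h1 : 0 ≤ θ * b * ∑' l : ℕ, (η (k + l)) ^ 2 := by positivity
    rw [ht, ← Real.rpow_mul h1, one_div, inv_mul_cancel₀ hθ0.ne', Real.rpow_one]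
    field_simp
  have hstep : ∀ k, ∑' l : ℕ, (η (k + l)) ^ 2
      = (η k) ^ 2 + ∑' l : ℕ, (η (k + 1 + l)) ^ 2 := by
    intro k
    have hs : Summable (fun l => (η (k + l)) ^ 2) := by
      have := (summable_nat_add_iff k).2 hsq
      simpa [add_comm] using this
    rw [hs.tsum_eq_zero_add]
    congr 1
    apply tsum_congr
    intro l
    rw [show k + (l + 1) = k + 1 + l by ring]
  intro k
  have heq : ξ k - ξ (k + 1) = F (x k) - F (x (k + 1)) + b * (η k) ^ 2 := by
    rw [hξ, hξ, htp, htp, hstep k]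
    ring
  refine ⟨heq, ?_⟩
  have := hdesc k
  rw [heq, norm_sub_rev]
  linarith
end

section
/- Let E be a real inner product space and F : E → ℝ be coercive, i.e., F(x) → +∞ as ‖x‖ → +∞. Let (x^k)_{k≥0}, (ω^k)_{k≥0} be sequences in E, a, b > 0, and (η_k)_{k≥0} a nonnegative sequence with ∑_k η_k < +∞. Suppose F(x^k) − F(x^{k+1}) ≥ a‖ω^{k+1} − ω^k‖² − b η_k² for all k. Then the sequence (x^k)_{k≥0} is bounded. -/
open Filter Topology

/-- If F is coercive and the pseudo sufficient descent condition holds with summable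
    noise, then the sequence (x^k) is bounded. -/
theorem bounded_of_coercive_pseudo_descent {E : Type*} [NormedAddCommGroup E]
    [InnerProductSpace ℝ E]
    (F : E → ℝ) (x ω : ℕ → E) (a b : ℝ) (η : ℕ → ℝ)
    (ha : 0 < a) (hb : 0 < b)
    (hcoercive : Tendsto F (Filter.comap (fun y => ‖y‖) atTop) atTop)
    (hη : ∀ k, 0 ≤ η k) (hsum : Summable η)
    (hdesc : ∀ k, F (x k) - F (x (k + 1)) ≥ a * ‖ω (k + 1) - ω k‖ ^ 2 - b * (η k) ^ 2) :
    ∃ R : ℝ, ∀ k, ‖x k‖ ≤ R := by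
  have h1 : ∀ k, F (x k) ≤ F (x 0) + b * ((∑' i, η i) * ∑ i ∈ Finset.range k, η i) := by
    intro k
    induction k with
    | zero => simp
    | succ k ih =>
      have hk : η k ≤ ∑' i, η i := hsum.le_tsum k (fun j _ => hη j)
      have h2 : b * (η k) ^ 2 ≤ b * ((∑' i, η i) * η k) := by
        rw [sq]
        exact mul_le_mul_of_nonneg_left (mul_le_mul_of_nonneg_right hk (hη k)) hb.le
      have h3 : 0 ≤ a * ‖ω (k + 1) - ω k‖ ^ 2 := by positivity
      have h4 := hdesc k
      rw [Finset.sum_range_succ, mul_add, mul_add]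
      linarith
  have hS : 0 ≤ ∑' i, η i := tsum_nonneg hη
  have h5 : ∀ k, F (x k) ≤ F (x 0) + b * ((∑' i, η i) * ∑' i, η i) := by
    intro k
    have h6 : ∑ i ∈ Finset.range k, η i ≤ ∑' i, η i :=
      hsum.sum_le_tsum _ (fun j _ => hη j)
    have h7 := mul_le_mul_of_nonneg_left (mul_le_mul_of_nonneg_left h6 hS) hb.le
    linarith [h1 k]
  have h8 := hcoercive.eventually (eventually_gt_atTop (F (x 0) + b * ((∑' i, η i) * ∑' i, η i)))
  rw [eventually_comap] at h8
  obtain ⟨R, hR⟩ := eventually_atTop.1 h8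
  refine ⟨R, fun k => ?_⟩
  by_contra hk
  push Not at hk
  exact absurd (hR _ hk.le (x k) rfl) (not_lt.2 (h5 k))
end

section
/- Let E be a real inner product space, f : E → ℝ differentiable with L-Lipschitz gradient (L > 0), g : E → ℝ, and 0 < h < 1/L. Let x, e ∈ E and suppose x⁺ ∈ E minimizes the function y ↦ h·g(y) + ‖y − (x − h∇f(x) + e)‖²/2 over E. Then, with F := f + g, F(x) − F(x⁺) ≥ (1/4)(1/h − L)‖x⁺ − x‖² − ‖e‖²/(h(1 − hL)). -/
open Filter Topology

/-- The descent lemma. -/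
theorem descent_aux {E : Type*} [NormedAddCommGroup E] [InnerProductSpace ℝ E]
    (f : E → ℝ) (f' : E → E) (L : ℝ)
    (hdiff : ∀ u, HasFDerivAt f (innerSL ℝ (f' u)) u)
    (hlip : ∀ u v, ‖f' u - f' v‖ ≤ L * ‖u - v‖) (x d : E) :
    f (x + d) ≤ f x + inner ℝ (f' x) d + L / 2 * ‖d‖ ^ 2 := by
  have hd : ∀ t : ℝ, HasDerivAt
      (fun t : ℝ => f (x + t • d) - t * inner ℝ (f' x) d - L / 2 * ‖d‖ ^ 2 * t ^ 2)
      (inner ℝ (f' (x + t • d)) d - inner ℝ (f' x) d - L * ‖d‖ ^ 2 * t) t := by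
    intro t
    have h1 : HasDerivAt (fun t : ℝ => x + t • d) d t := by
      simpa using ((hasDerivAt_id t).smul_const d).const_add x
    have h2 := (hdiff (x + t • d)).comp_hasDerivAt t h1
    have h3 := (hasDerivAt_id t).mul_const (inner ℝ (f' x) d)
    have h4 := ((hasDerivAt_id t).pow 2).const_mul (L / 2 * ‖d‖ ^ 2)
    refine HasDerivAt.congr_deriv ((h2.sub h3).sub h4) ?_
    simp only [innerSL_apply_apply, id, Nat.cast_ofNat]
    ring
  have hanti : AntitoneOn
      (fun t : ℝ => f (x + t • d) - t * inner ℝ (f' x) d - L / 2 * ‖d‖ ^ 2 * t ^ 2)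
      (Set.Icc 0 1) := by
    apply antitoneOn_of_deriv_nonpos (convex_Icc 0 1)
    · exact fun t _ => (hd t).continuousAt.continuousWithinAt
    · exact fun t _ => (hd t).differentiableAt.differentiableWithinAt
    · intro t ht
      rw [interior_Icc] at ht
      rw [(hd t).deriv, ← inner_sub_left]
      have h1 := real_inner_le_norm (f' (x + t • d) - f' x) d
      have h2 := hlip (x + t • d) x
      rw [add_sub_cancel_left, norm_smul, Real.norm_of_nonneg ht.1.le] at h2
      have h3 := mul_le_mul_of_nonneg_right h2 (norm_nonneg d)
      nlinarith
  have := hanti (Set.left_mem_Icc.2 zero_le_one) (Set.right_mem_Icc.2 zero_le_one) zero_le_one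
  simp at this
  linarith

/-- Pseudo sufficient descent for one step of the inexact proximal gradient method:
    if x⁺ ∈ prox_{hg}(x − h∇f(x) + e) and 0 < h < 1/L, then
    F(x) − F(x⁺) ≥ (1/4)(1/h − L)‖x⁺ − x‖² − ‖e‖²/(h(1 − hL)), F = f + g. -/
theorem inexact_prox_grad_descent {E : Type*} [NormedAddCommGroup E]
    [InnerProductSpace ℝ E]
    (f g : E → ℝ) (f' : E → E) (L h : ℝ) (hL : 0 < L)
    (hdiff : ∀ u, HasFDerivAt f (innerSL ℝ (f' u)) u)
    (hlip : ∀ u v, ‖f' u - f' v‖ ≤ L * ‖u - v‖)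
    (hh : 0 < h) (hhL : h < 1 / L)
    (x e xp : E)
    (hmin : ∀ y, h * g xp + ‖xp - (x - h • f' x + e)‖ ^ 2 / 2 ≤
                 h * g y + ‖y - (x - h • f' x + e)‖ ^ 2 / 2) :
    (f x + g x) - (f xp + g xp) ≥
      (1 / 4) * (1 / h - L) * ‖xp - x‖ ^ 2 - ‖e‖ ^ 2 / (h * (1 - h * L)) := by
  have hc : 0 < 1 - h * L := by
    rw [lt_div_iff₀ hL] at hhL
    linarith
  obtain ⟨d, rfl⟩ : ∃ d, xp = x + d := ⟨xp - x, by abel⟩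
  have hD := descent_aux f f' L hdiff hlip x d
  have hm := hmin x
  rw [show x + d - (x - h • f' x + e) = d + (h • f' x - e) by abel,
    show x - (x - h • f' x + e) = h • f' x - e by abel,
    norm_add_sq_real, inner_sub_right, inner_smul_right, real_inner_comm] at hm
  rw [add_sub_cancel_left]
  have hy : inner ℝ d e ≤ (1 - h * L) / 4 * ‖d‖ ^ 2 + ‖e‖ ^ 2 / (1 - h * L) := by
    refine (real_inner_le_norm d e).trans ?_
    have : (1 - h * L) / 4 * ‖d‖ ^ 2 + ‖e‖ ^ 2 / (1 - h * L) - ‖d‖ * ‖e‖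
        = ((1 - h * L) / 2 * ‖d‖ - ‖e‖) ^ 2 / (1 - h * L) := by
      field_simp
      ring
    have h2 : 0 ≤ ((1 - h * L) / 2 * ‖d‖ - ‖e‖) ^ 2 / (1 - h * L) := by positivity
    linarith
  have hE : (1 / 4) * (1 / h - L) * ‖d‖ ^ 2 - ‖e‖ ^ 2 / (h * (1 - h * L))
      = ((1 - h * L) / 4 * ‖d‖ ^ 2 - ‖e‖ ^ 2 / (1 - h * L)) / h := by
    field_simp
  rw [ge_iff_le, hE, div_le_iff₀ hh]
  have hD2 := mul_le_mul_of_nonneg_left hD hh.le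
  linarith
end

section
/- Let E be a real inner product space, f : E → ℝ differentiable with continuous gradient, g : E → ℝ lower semicontinuous, h > 0, and let (x^k)_{k≥0}, (e^k)_{k≥0} ⊆ E satisfy: for every k, x^{k+1} minimizes y ↦ h·g(y) + ‖y − (x^k − h∇f(x^k) + e^k)‖²/2 over E, and e^k → 0. Suppose (k_j)_{j≥0} is a strictly increasing sequence of indices with k_j ≥ 1 such that x^{k_j} → x* and x^{k_j−1} → x* for some x* ∈ E. Then g(x^{k_j}) → g(x*), and hence F(x^{k_j}) → F(x*) where F := f + g. -/
open Filter Topology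

/-- Continuity condition for the inexact proximal gradient algorithm: along a
    subsequence converging (together with its shifted companion) to x*, the values
    g(x^{k_j}) and F(x^{k_j}) converge to g(x*) and F(x*). -/
theorem inexact_prox_grad_continuity {E : Type*} [NormedAddCommGroup E]
    [InnerProductSpace ℝ E]
    (f g : E → ℝ) (f' : E → E) (h : ℝ) (hh : 0 < h)
    (hdiff : ∀ u, HasFDerivAt f (innerSL ℝ (f' u)) u)
    (hcont : Continuous f')
    (hlsc : LowerSemicontinuous g)
    (x e : ℕ → E)
    (hmin : ∀ k, ∀ y,
      h * g (x (k + 1)) + ‖x (k + 1) - (x k - h • f' (x k) + e k)‖ ^ 2 / 2 ≤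
        h * g y + ‖y - (x k - h • f' (x k) + e k)‖ ^ 2 / 2)
    (he : Tendsto e atTop (𝓝 0))
    (kj : ℕ → ℕ) (hmono : StrictMono kj) (hkj : ∀ j, 1 ≤ kj j) (xs : E)
    (hconv : Tendsto (fun j => x (kj j)) atTop (𝓝 xs))
    (hconv' : Tendsto (fun j => x (kj j - 1)) atTop (𝓝 xs)) :
    Tendsto (fun j => g (x (kj j))) atTop (𝓝 (g xs)) ∧
      Tendsto (fun j => f (x (kj j)) + g (x (kj j))) atTop (𝓝 (f xs + g xs)) := by
  have hk1 : Tendsto (fun j => kj j - 1) atTop atTop :=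
    (tendsto_sub_atTop_nat 1).comp hmono.tendsto_atTop
  have hp : Tendsto (fun j => x (kj j - 1) - h • f' (x (kj j - 1)) + e (kj j - 1)) atTop
      (𝓝 (xs - h • f' xs + 0)) :=
    (hconv'.sub (((hcont.tendsto xs).comp hconv').const_smul h)).add (he.comp hk1)
  have hub : Tendsto (fun j => g xs +
      (‖xs - (x (kj j - 1) - h • f' (x (kj j - 1)) + e (kj j - 1))‖ ^ 2 -
        ‖x (kj j) - (x (kj j - 1) - h • f' (x (kj j - 1)) + e (kj j - 1))‖ ^ 2) / (2 * h))
      atTop (𝓝 (g xs)) := by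
    have := (((((tendsto_const_nhds (x := xs)).sub hp).norm.pow 2).sub
      ((hconv.sub hp).norm.pow 2)).div_const (2 * h)).const_add (g xs)
    simpa only [sub_self, zero_div, add_zero] using this
  have hle : ∀ j, g (x (kj j)) ≤ g xs +
      (‖xs - (x (kj j - 1) - h • f' (x (kj j - 1)) + e (kj j - 1))‖ ^ 2 -
        ‖x (kj j) - (x (kj j - 1) - h • f' (x (kj j - 1)) + e (kj j - 1))‖ ^ 2) / (2 * h) := by
    intro j
    have h1 := hmin (kj j - 1) xs
    rw [Nat.sub_add_cancel (hkj j)] at h1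
    rw [← sub_le_iff_le_add', le_div_iff₀ (by positivity)]
    linarith
  have hg : Tendsto (fun j => g (x (kj j))) atTop (𝓝 (g xs)) := by
    rw [tendsto_order]
    constructor
    · intro a ha
      exact hconv.eventually (hlsc xs a ha)
    · intro a ha
      filter_upwards [hub.eventually (gt_mem_nhds ha)] with j hj
      exact (hle j).trans_lt hj
  exact ⟨hg, ((hdiff xs).continuousAt.tendsto.comp hconv).add hg⟩
end

section
/- Let E₁, E₂ be real inner product spaces, H : E₁ × E₂ → ℝ differentiable, f : E₁ → ℝ, g : E₂ → ℝ. Assume the partial gradients satisfy ‖∇_y H(y¹, z) − ∇_y H(y², z)‖ ≤ M‖y¹ − y²‖ for all y¹, y², z, and ‖∇_z H(y, z¹) − ∇_z H(y, z²)‖ ≤ N‖z¹ − z²‖ for all y, z¹, z², with M, N > 0. Let 0 < γ < 1/M and 0 < λ < 1/N. Let (y₀, z₀) ∈ E₁ × E₂ and noises a ∈ E₁, b ∈ E₂, and suppose y⁺ minimizes y ↦ γf(y) + ‖y − (y₀ − γ∇_y H(y₀, z₀) + a)‖²/2 over E₁ and z⁺ minimizes z ↦ λg(z) + ‖z − (z₀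 − λ∇_z H(y⁺, z₀) + b)‖²/2 over E₂. Then, with Φ(y, z) := f(y) + H(y, z) + g(z), Φ(y₀, z₀) − Φ(y⁺, z⁺) ≥ (1/4)(1/γ − M)‖y⁺ − y₀‖² + (1/4)(1/λ − N)‖z⁺ − z₀‖² − ‖a‖²/(γ(1 − γM)) − ‖b‖²/(λ(1 − λN)). -/
open Filter Topology

theorem palm_descent_lemma {E : Type*} [NormedAddCommGroup E] [InnerProductSpace ℝ E]
    (h : E → ℝ) (G : E → E) (M : ℝ)
    (hd : ∀ y, HasFDerivAt h (innerSL ℝ (G y)) y)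
    (hlip : ∀ y₁ y₂, ‖G y₁ - G y₂‖ ≤ M * ‖y₁ - y₂‖) (x d : E) :
    h (x + d) ≤ h x + inner ℝ (G x) d + M / 2 * ‖d‖ ^ 2 := by
  have key : ∀ t : ℝ, HasDerivAt
      (fun t : ℝ => h (x + t • d) - t * inner ℝ (G x) d - M / 2 * ‖d‖ ^ 2 * t ^ 2)
      (inner ℝ (G (x + t • d)) d - inner ℝ (G x) d - M * ‖d‖ ^ 2 * t) t := by
    intro t
    have h1 : HasDerivAt (fun t : ℝ => x + t • d) d t := by
      simpa using ((hasDerivAt_id t).smul_const d).const_add x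
    have h2 : HasDerivAt (fun t : ℝ => h (x + t • d)) (inner ℝ (G (x + t • d)) d) t := by
      simpa [Function.comp_def] using (hd (x + t • d)).comp_hasDerivAt t h1
    have h3 : HasDerivAt (fun t : ℝ => t * inner ℝ (G x) d) (inner ℝ (G x) d) t := by
      simpa using (hasDerivAt_id t).mul_const (inner ℝ (G x) d)
    have h4 : HasDerivAt (fun t : ℝ => M / 2 * ‖d‖ ^ 2 * t ^ 2) (M * ‖d‖ ^ 2 * t) t := by
      have h5 := (hasDerivAt_pow 2 t).const_mul (M / 2 * ‖d‖ ^ 2)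
      have e : M / 2 * ‖d‖ ^ 2 * (((2 : ℕ) : ℝ) * t ^ (2 - 1)) = M * ‖d‖ ^ 2 * t := by
        norm_num
        ring
      rw [e] at h5
      exact h5
    exact (h2.sub h3).sub h4
  have anti := antitoneOn_of_deriv_nonpos (convex_Icc (0 : ℝ) 1)
    (fun t _ => (key t).continuousAt.continuousWithinAt)
    (fun t _ => (key t).differentiableAt.differentiableWithinAt)
    (by
      intro t ht
      rw [interior_Icc] at ht
      rw [(key t).deriv, ← inner_sub_left]
      have h5 := real_inner_le_norm (G (x + t • d) - G x) d
      have h6 := hlip (x + t • d) x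
      rw [add_sub_cancel_left, norm_smul, Real.norm_of_nonneg ht.1.le] at h6
      have h7 := mul_le_mul_of_nonneg_right h6 (norm_nonneg d)
      nlinarith)
  have := anti (Set.left_mem_Icc.2 zero_le_one) (Set.right_mem_Icc.2 zero_le_one) zero_le_one
  simp at this
  linarith

theorem palm_block {E : Type*} [NormedAddCommGroup E] [InnerProductSpace ℝ E]
    (h f : E → ℝ) (G : E → E) (M γ : ℝ) (hM : 0 < M)
    (hd : ∀ y, HasFDerivAt h (innerSL ℝ (G y)) y)
    (hlip : ∀ y₁ y₂, ‖G y₁ - G y₂‖ ≤ M * ‖y₁ - y₂‖)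
    (hγ : 0 < γ) (hγM : γ < 1 / M) (x p a : E)
    (hmin : γ * f p + ‖p - (x - γ • G x + a)‖ ^ 2 / 2 ≤
      γ * f x + ‖x - (x - γ • G x + a)‖ ^ 2 / 2) :
    (1 / 4) * (1 / γ - M) * ‖p - x‖ ^ 2 - ‖a‖ ^ 2 / (γ * (1 - γ * M)) ≤
      (f x + h x) - (f p + h p) := by
  obtain ⟨d, rfl⟩ : ∃ d, p = x + d := ⟨p - x, by abel⟩
  have h1 := palm_descent_lemma h G M hd hlip x d
  have hc : 0 < 1 - γ * M := by
    rw [lt_div_iff₀ hM] at hγM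
    linarith
  have e1 : x + d - (x - γ • G x + a) = d + (γ • G x - a) := by abel
  have e2 : x - (x - γ • G x + a) = γ • G x - a := by abel
  rw [e1, e2, norm_add_sq_real, inner_sub_right, inner_smul_right, real_inner_comm] at hmin
  rw [add_sub_cancel_left]
  have h2 := real_inner_le_norm d a
  have h3 : ‖d‖ * ‖a‖ ≤ (1 - γ * M) / 4 * ‖d‖ ^ 2 + ‖a‖ ^ 2 / (1 - γ * M) := by
    have : (1 - γ * M) / 4 * ‖d‖ ^ 2 + ‖a‖ ^ 2 / (1 - γ * M) - ‖d‖ * ‖a‖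
        = ((1 - γ * M) / 2 * ‖d‖ - ‖a‖) ^ 2 / (1 - γ * M) := by
      field_simp
      ring
    have h4 : 0 ≤ ((1 - γ * M) / 2 * ‖d‖ - ‖a‖) ^ 2 / (1 - γ * M) := by positivity
    linarith
  have h5 : γ * ((1 / 4) * (1 / γ - M) * ‖d‖ ^ 2 - ‖a‖ ^ 2 / (γ * (1 - γ * M)))
      = (1 - γ * M) / 4 * ‖d‖ ^ 2 - ‖a‖ ^ 2 / (1 - γ * M) := by
    field_simp
  have h6 := mul_le_mul_of_nonneg_left h1 hγ.le
  refine le_of_mul_le_mul_left ?_ hγ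
  rw [h5]
  nlinarith

/-- Pseudo sufficient descent for one iteration of the inexact proximal alternating
    linearized minimization (PALM) algorithm for Φ(y,z) = f(y) + H(y,z) + g(z). -/
theorem inexact_palm_descent {E₁ E₂ : Type*}
    [NormedAddCommGroup E₁] [InnerProductSpace ℝ E₁]
    [NormedAddCommGroup E₂] [InnerProductSpace ℝ E₂]
    (H : E₁ × E₂ → ℝ) (f : E₁ → ℝ) (g : E₂ → ℝ)
    (Hy : E₁ × E₂ → E₁) (Hz : E₁ × E₂ → E₂) (M N γ lam : ℝ)
    (hM : 0 < M) (hN : 0 < N)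
    (hdy : ∀ (y : E₁) (z : E₂), HasFDerivAt (fun y' => H (y', z)) (innerSL ℝ (Hy (y, z))) y)
    (hdz : ∀ (y : E₁) (z : E₂), HasFDerivAt (fun z' => H (y, z')) (innerSL ℝ (Hz (y, z))) z)
    (hlipy : ∀ (y₁ y₂ : E₁) (z : E₂), ‖Hy (y₁, z) - Hy (y₂, z)‖ ≤ M * ‖y₁ - y₂‖)
    (hlipz : ∀ (y : E₁) (z₁ z₂ : E₂), ‖Hz (y, z₁) - Hz (y, z₂)‖ ≤ N * ‖z₁ - z₂‖)
    (hγ : 0 < γ) (hγM : γ < 1 / M) (hlam : 0 < lam) (hlamN : lam < 1 / N)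
    (y₀ yp : E₁) (z₀ zp : E₂) (a : E₁) (b : E₂)
    (hminy : ∀ y, γ * f yp + ‖yp - (y₀ - γ • Hy (y₀, z₀) + a)‖ ^ 2 / 2 ≤
                  γ * f y + ‖y - (y₀ - γ • Hy (y₀, z₀) + a)‖ ^ 2 / 2)
    (hminz : ∀ z, lam * g zp + ‖zp - (z₀ - lam • Hz (yp, z₀) + b)‖ ^ 2 / 2 ≤
                  lam * g z + ‖z - (z₀ - lam • Hz (yp, z₀) + b)‖ ^ 2 / 2) :
    (f y₀ + H (y₀, z₀) + g z₀) - (f yp + H (yp, zp) + g zp) ≥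
      (1 / 4) * (1 / γ - M) * ‖yp - y₀‖ ^ 2 + (1 / 4) * (1 / lam - N) * ‖zp - z₀‖ ^ 2
        - ‖a‖ ^ 2 / (γ * (1 - γ * M)) - ‖b‖ ^ 2 / (lam * (1 - lam * N)) := by
  have A := palm_block (fun y => H (y, z₀)) f (fun y => Hy (y, z₀)) M γ hM
    (fun y => hdy y z₀) (fun y₁ y₂ => hlipy y₁ y₂ z₀) hγ hγM y₀ yp a (hminy y₀)
  have B := palm_block (fun z => H (yp, z)) g (fun z => Hz (yp, z)) N lam hN
    (fun z => hdz yp z) (fun z₁ z₂ => hlipz yp z₁ z₂) hlam hlamN z₀ zp b (hminz z₀)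
  linarith
end

section
/- Let E₁, E₂ be real inner product spaces, H : E₁ × E₂ → ℝ continuous and differentiable with continuous partial gradients, f : E₁ → ℝ and g : E₂ → ℝ lower semicontinuous, γ, λ > 0. Let sequences (y^k), (z^k), (a^k), (b^k) satisfy: for every k, y^{k+1} minimizes y ↦ γf(y) + ‖y − (y^k − γ∇_y H(y^k, z^k) + a^k)‖²/2 and z^{k+1} minimizes z ↦ λg(z) + ‖z − (z^k − λ∇_z H(y^{k+1}, z^k) + b^k)‖²/2, with a^k → 0 and b^k → 0. Suppose (k_j) is a strictly increasing sequence of indices with k_j ≥ 1 such that (y^{k_j}, z^{k_j}) → (y*, z*) and (y^{k_j−1}, z^{k_j−1}) → (y*, z*). Then f(y^{k_j}) → f(y*), g(z^{k_j}) → g(z*), and Φ(y^{k_j}, z^{k_j}) → Φ(y*, z*) where Φ(y, z) := f(y) + H(y, z) + g(z). -/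
open Filter Topology

theorem prox_value_tendsto {E : Type*} [NormedAddCommGroup E] [InnerProductSpace ℝ E]
    (f : E → ℝ) (hf : LowerSemicontinuous f) (c : ℝ) (hc : 0 < c)
    (x w : ℕ → E) (xs ws : E) (hx : Tendsto x atTop (𝓝 xs)) (hw : Tendsto w atTop (𝓝 ws))
    (hmin : ∀ j, c * f (x j) + ‖x j - w j‖ ^ 2 / 2 ≤ c * f xs + ‖xs - w j‖ ^ 2 / 2) :
    Tendsto (fun j => f (x j)) atTop (𝓝 (f xs)) := by
  have hU : Tendsto (fun j => f xs + (‖xs - w j‖ ^ 2 / 2 - ‖x j - w j‖ ^ 2 / 2) / c) atTop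
      (𝓝 (f xs + (‖xs - ws‖ ^ 2 / 2 - ‖xs - ws‖ ^ 2 / 2) / c)) :=
    ((((((tendsto_const_nhds.sub hw).norm).pow 2).div_const 2).sub
      ((((hx.sub hw).norm).pow 2).div_const 2)).div_const c).const_add _
  rw [sub_self, zero_div, add_zero] at hU
  refine tendsto_order.2 ⟨fun l hl => hx.eventually (hf xs l hl), fun u hu => ?_⟩
  filter_upwards [(tendsto_order.1 hU).2 u hu] with j hj
  refine lt_of_le_of_lt ?_ hj
  have h := hmin j
  rw [← sub_le_iff_le_add', le_div_iff₀ hc]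
  linarith

/-- Continuity condition for the inexact PALM algorithm: along a subsequence
    converging (together with its shifted companion) to (y*, z*), the values
    f(y^{k_j}), g(z^{k_j}) and Φ(y^{k_j}, z^{k_j}) converge to f(y*), g(z*), Φ(y*,z*). -/
theorem inexact_palm_continuity {E₁ E₂ : Type*}
    [NormedAddCommGroup E₁] [InnerProductSpace ℝ E₁]
    [NormedAddCommGroup E₂] [InnerProductSpace ℝ E₂]
    (H : E₁ × E₂ → ℝ) (f : E₁ → ℝ) (g : E₂ → ℝ)
    (Hy : E₁ × E₂ → E₁) (Hz : E₁ × E₂ → E₂) (γ lam : ℝ)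
    (hγ : 0 < γ) (hlam : 0 < lam)
    (hHcont : Continuous H)
    (hdy : ∀ (y : E₁) (z : E₂), HasFDerivAt (fun y' => H (y', z)) (innerSL ℝ (Hy (y, z))) y)
    (hdz : ∀ (y : E₁) (z : E₂), HasFDerivAt (fun z' => H (y, z')) (innerSL ℝ (Hz (y, z))) z)
    (hHycont : Continuous Hy) (hHzcont : Continuous Hz)
    (hflsc : LowerSemicontinuous f) (hglsc : LowerSemicontinuous g)
    (y : ℕ → E₁) (z : ℕ → E₂) (a : ℕ → E₁) (b : ℕ → E₂)
    (hminy : ∀ k, ∀ u : E₁,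
      γ * f (y (k + 1)) + ‖y (k + 1) - (y k - γ • Hy (y k, z k) + a k)‖ ^ 2 / 2 ≤
        γ * f u + ‖u - (y k - γ • Hy (y k, z k) + a k)‖ ^ 2 / 2)
    (hminz : ∀ k, ∀ u : E₂,
      lam * g (z (k + 1)) + ‖z (k + 1) - (z k - lam • Hz (y (k + 1), z k) + b k)‖ ^ 2 / 2 ≤
        lam * g u + ‖u - (z k - lam • Hz (y (k + 1), z k) + b k)‖ ^ 2 / 2)
    (ha : Tendsto a atTop (𝓝 0)) (hb : Tendsto b atTop (𝓝 0))
    (kj : ℕ → ℕ) (hmono : StrictMono kj) (hkj : ∀ j, 1 ≤ kj j)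
    (ys : E₁) (zs : E₂)
    (hconv : Tendsto (fun j => (y (kj j), z (kj j))) atTop (𝓝 (ys, zs)))
    (hconv' : Tendsto (fun j => (y (kj j - 1), z (kj j - 1))) atTop (𝓝 (ys, zs))) :
    Tendsto (fun j => f (y (kj j))) atTop (𝓝 (f ys)) ∧
      Tendsto (fun j => g (z (kj j))) atTop (𝓝 (g zs)) ∧
        Tendsto (fun j => f (y (kj j)) + H (y (kj j), z (kj j)) + g (z (kj j)))
          atTop (𝓝 (f ys + H (ys, zs) + g zs)) := by
  have hy : Tendsto (fun j => y (kj j)) atTop (𝓝 ys) := hconv.fst_nhds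
  have hz : Tendsto (fun j => z (kj j)) atTop (𝓝 zs) := hconv.snd_nhds
  have hy' : Tendsto (fun j => y (kj j - 1)) atTop (𝓝 ys) := hconv'.fst_nhds
  have hz' : Tendsto (fun j => z (kj j - 1)) atTop (𝓝 zs) := hconv'.snd_nhds
  have hk : Tendsto (fun j => kj j - 1) atTop atTop :=
    (tendsto_sub_atTop_nat 1).comp hmono.tendsto_atTop
  have hF : Tendsto (fun j => f (y (kj j))) atTop (𝓝 (f ys)) := by
    refine prox_value_tendsto f hflsc γ hγ (fun j => y (kj j))
      (fun j => y (kj j - 1) - γ • Hy (y (kj j - 1), z (kj j - 1)) + a (kj j - 1)) ys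
      (ys - γ • Hy (ys, zs) + 0) hy
      ((hy'.sub (((hHycont.tendsto _).comp hconv').const_smul γ)).add (ha.comp hk)) ?_
    intro j
    have h := hminy (kj j - 1) ys
    rwa [Nat.sub_add_cancel (hkj j)] at h
  have hG : Tendsto (fun j => g (z (kj j))) atTop (𝓝 (g zs)) := by
    refine prox_value_tendsto g hglsc lam hlam (fun j => z (kj j))
      (fun j => z (kj j - 1) - lam • Hz (y (kj j), z (kj j - 1)) + b (kj j - 1)) zs
      (zs - lam • Hz (ys, zs) + 0) hz
      ((hz'.sub (((hHzcont.tendsto _).comp (hy.prodMk_nhds hz')).const_smul lam)).add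
        (hb.comp hk)) ?_
    intro j
    have h := hminz (kj j - 1) zs
    rwa [Nat.sub_add_cancel (hkj j)] at h
  exact ⟨hF, hG, (hF.add ((hHcont.tendsto _).comp hconv)).add hG⟩
end

section
/- Let E be a real inner product space, f, h : E → ℝ differentiable with continuous gradients, g : E → ℝ lower semicontinuous, γ > 0. Let (x^k), (e^k) satisfy: for every k, x^{k+1} minimizes y ↦ γ·g(y) + ‖y − (x^k − γ(∇f(x^k) − ∇h(x^k)) + e^k)‖²/2 over E, and e^k → 0. Suppose (k_j) is a strictly increasing sequence of indices with k_j ≥ 1 such that x^{k_j} → x* and x^{k_j−1} → x*. Then g(x^{k_j}) → g(x*) and Ξ(x^{k_j}) → Ξ(x*), where Ξ := f + g − h. -/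
open Filter Topology

/-- Continuity condition for the inexact DC algorithm: along a subsequence converging
    (together with its shifted companion) to x*, g(x^{k_j}) → g(x*) and
    Ξ(x^{k_j}) → Ξ(x*), with Ξ = f + g − h. -/
theorem inexact_dc_continuity {E : Type*} [NormedAddCommGroup E] [InnerProductSpace ℝ E]
    (f g h : E → ℝ) (f' h' : E → E) (γ : ℝ) (hγ : 0 < γ)
    (hfdiff : ∀ u, HasFDerivAt f (innerSL ℝ (f' u)) u)
    (hhdiff : ∀ u, HasFDerivAt h (innerSL ℝ (h' u)) u)
    (hfcont : Continuous f') (hhcont : Continuous h')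
    (hlsc : LowerSemicontinuous g)
    (x e : ℕ → E)
    (hmin : ∀ k, ∀ y,
      γ * g (x (k + 1)) + ‖x (k + 1) - (x k - γ • (f' (x k) - h' (x k)) + e k)‖ ^ 2 / 2 ≤
        γ * g y + ‖y - (x k - γ • (f' (x k) - h' (x k)) + e k)‖ ^ 2 / 2)
    (he : Tendsto e atTop (𝓝 0))
    (kj : ℕ → ℕ) (hmono : StrictMono kj) (hkj : ∀ j, 1 ≤ kj j) (xs : E)
    (hconv : Tendsto (fun j => x (kj j)) atTop (𝓝 xs))
    (hconv' : Tendsto (fun j => x (kj j - 1)) atTop (𝓝 xs)) :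
    Tendsto (fun j => g (x (kj j))) atTop (𝓝 (g xs)) ∧
      Tendsto (fun j => f (x (kj j)) + g (x (kj j)) - h (x (kj j)))
        atTop (𝓝 (f xs + g xs - h xs)) := by
  have hk : Tendsto (fun j => kj j - 1) atTop atTop :=
    (tendsto_sub_atTop_nat 1).comp hmono.tendsto_atTop
  have he' : Tendsto (fun j => e (kj j - 1)) atTop (𝓝 0) := he.comp hk
  have hf1 : Tendsto (fun j => f' (x (kj j - 1))) atTop (𝓝 (f' xs)) :=
    (hfcont.tendsto xs).comp hconv'
  have hh1 : Tendsto (fun j => h' (x (kj j - 1))) atTop (𝓝 (h' xs)) :=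
    (hhcont.tendsto xs).comp hconv'
  have hu := (hconv'.sub ((hf1.sub hh1).const_smul γ)).add he'
  have ha := ((tendsto_const_nhds (x := xs)).sub hu).norm.pow 2
  have hb := (hconv.sub hu).norm.pow 2
  have hB := (((ha.sub hb).div_const 2).div_const γ).const_add (g xs)
  simp only [sub_self, zero_div, add_zero] at hB
  have hg : Tendsto (fun j => g (x (kj j))) atTop (𝓝 (g xs)) := by
    rw [tendsto_order]
    constructor
    · intro a ha
      exact hconv.eventually (hlsc xs a ha)
    · intro a ha
      filter_upwards [(tendsto_order.1 hB).2 a ha] with j hj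
      refine lt_of_le_of_lt ?_ hj
      have h1 := hmin (kj j - 1) xs
      rw [Nat.sub_add_cancel (hkj j)] at h1
      rw [← sub_le_iff_le_add', le_div_iff₀ hγ]
      linarith
  refine ⟨hg, ?_⟩
  exact (((hfdiff xs).continuousAt.tendsto.comp hconv).add hg).sub
    ((hhdiff xs).continuousAt.tendsto.comp hconv)
end

section
/- Let E be a real inner product space, f : E → ℝ, g : E → ℝ, α > 0, β > 0, and define the augmented Lagrangian L_β(x, y, γ) := f(x) + g(y) + ⟨γ, x + y⟩ + (β/2)‖x + y‖². Let x, y, γ, e₁ ∈ E and suppose x⁺ minimizes u ↦ f(u)/(α+β) + ‖u − ((α x − β y − γ)/(α+β) + e₁)‖²/2 over E. Then L_β(x⁺, y, γ) + (α/4)‖x⁺ − x‖² ≤ L_β(x, y, γ) + ((α+β)²/α)‖e₁‖². -/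
open Filter Topology RealInnerProductSpace

/-- Descent of the augmented Lagrangian along the inexact ADMM x-update
    x⁺ = prox_{f/(α+β)}((αx − βy − γ)/(α+β) + e₁). -/
theorem inexact_admm_x_descent {E : Type*} [NormedAddCommGroup E]
    [InnerProductSpace ℝ E]
    (f g : E → ℝ) (α β : ℝ) (hα : 0 < α) (hβ : 0 < β)
    (Lb : E → E → E → ℝ)
    (hLb : ∀ x y γ, Lb x y γ = f x + g y + ⟪γ, x + y⟫ + (β / 2) * ‖x + y‖ ^ 2)
    (x y γ e₁ xp : E)
    (hmin : ∀ u,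
      f xp / (α + β) + ‖xp - ((α + β)⁻¹ • (α • x - β • y - γ) + e₁)‖ ^ 2 / 2 ≤
        f u / (α + β) + ‖u - ((α + β)⁻¹ • (α • x - β • y - γ) + e₁)‖ ^ 2 / 2) :
    Lb xp y γ + (α / 4) * ‖xp - x‖ ^ 2 ≤ Lb x y γ + ((α + β) ^ 2 / α) * ‖e₁‖ ^ 2 := by
  have hs : 0 < α + β := by linarith
  have key : ∀ u : E, (α + β) * (f u / (α + β) +
      ‖u - ((α + β)⁻¹ • (α • x - β • y - γ) + e₁)‖ ^ 2 / 2) =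
      f u + (α + β) / 2 * ‖u‖ ^ 2 - (α * ⟪u, x⟫ - β * ⟪u, y⟫ - ⟪u, γ⟫) - (α + β) * ⟪u, e₁⟫
      + (α + β) / 2 * ‖(α + β)⁻¹ • (α • x - β • y - γ) + e₁‖ ^ 2 := by
    intro u
    rw [norm_sub_sq_real u]
    simp only [inner_add_right, inner_sub_right, real_inner_smul_right]
    field_simp
    ring
  have h := mul_le_mul_of_nonneg_left (hmin x) hs.le
  rw [key, key] at h
  have hy : 0 ≤ ‖(α / 2) • (xp - x) - (α + β) • e₁‖ ^ 2 / α := by positivity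
  have hy2 : ‖(α / 2) • (xp - x) - (α + β) • e₁‖ ^ 2 / α =
      α / 4 * ‖xp - x‖ ^ 2 - (α + β) * (⟪xp, e₁⟫ - ⟪x, e₁⟫) + (α + β) ^ 2 / α * ‖e₁‖ ^ 2 := by
    rw [norm_sub_sq_real, norm_smul, norm_smul, mul_pow, mul_pow, Real.norm_eq_abs,
      Real.norm_eq_abs, sq_abs, sq_abs, real_inner_smul_left, real_inner_smul_right,
      inner_sub_left]
    field_simp
    ring
  rw [hy2] at hy
  rw [hLb, hLb]
  rw [norm_sub_sq_real] at hy ⊢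
  rw [norm_add_sq_real, norm_add_sq_real, inner_add_right, inner_add_right,
    real_inner_comm xp γ, real_inner_comm x γ]
  rw [real_inner_self_eq_norm_sq] at h
  linarith
end

section
/- Let E be a real inner product space, f : E → ℝ, g : E → ℝ convex and differentiable with L_g-Lipschitz gradient, and β > L_g > 0. Define L_β(x, y, γ) := f(x) + g(y) + ⟨γ, x + y⟩ + (β/2)‖x + y‖². Let x⁺, y, γ, e₂ ∈ E and suppose y⁺ minimizes v ↦ g(v)/β + ‖v − (−x⁺ − γ/β + e₂)‖²/2 over E. Then L_β(x⁺, y⁺, γ) + ((β − L_g)/4)‖y⁺ − y‖² ≤ L_β(x⁺, y, γ) + (β²/(β − L_g))‖e₂‖². -/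
open Filter Topology RealInnerProductSpace

/-- Descent of the augmented Lagrangian along the inexact ADMM y-update
    y⁺ = prox_{g/β}(−x⁺ − γ/β + e₂), for g convex with L_g-Lipschitz gradient
    and β > L_g. -/
theorem inexact_admm_y_descent {E : Type*} [NormedAddCommGroup E]
    [InnerProductSpace ℝ E]
    (f g : E → ℝ) (g' : E → E) (Lg β : ℝ) (hLg : 0 < Lg) (hβ : Lg < β)
    (hgconv : ConvexOn ℝ Set.univ g)
    (hgdiff : ∀ u, HasFDerivAt g (innerSL ℝ (g' u)) u)
    (hglip : ∀ u v, ‖g' u - g' v‖ ≤ Lg * ‖u - v‖)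
    (Lb : E → E → E → ℝ)
    (hLb : ∀ x y γ, Lb x y γ = f x + g y + ⟪γ, x + y⟫ + (β / 2) * ‖x + y‖ ^ 2)
    (xp y γ e₂ yp : E)
    (hmin : ∀ v, g yp / β + ‖yp - (-xp - β⁻¹ • γ + e₂)‖ ^ 2 / 2 ≤
                 g v / β + ‖v - (-xp - β⁻¹ • γ + e₂)‖ ^ 2 / 2) :
    Lb xp yp γ + ((β - Lg) / 4) * ‖yp - y‖ ^ 2 ≤
      Lb xp y γ + (β ^ 2 / (β - Lg)) * ‖e₂‖ ^ 2 := by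
  have hb : 0 < β := hLg.trans hβ
  have hbL : 0 < β - Lg := sub_pos.2 hβ
  set w := yp - (-xp - β⁻¹ • γ + e₂) with hw
  obtain ⟨d, hd⟩ : ∃ d, d = y - yp := ⟨_, rfl⟩
  have hy : y = yp + d := by rw [hd]; abel
  have key : ∀ t : ℝ, 0 < t → t ≤ 1 →
      0 ≤ (g y - g yp) / β + ⟪w, d⟫ + t / 2 * ‖d‖ ^ 2 := by
    intro t ht ht1
    have h1 := hmin (yp + t • d)
    have h2 := hgconv.2 (Set.mem_univ yp) (Set.mem_univ y) (sub_nonneg.2 ht1) ht.le (by ring)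
    have e1 : (1 - t) • yp + t • y = yp + t • d := by rw [hd]; module
    have e2 : yp + t • d - (-xp - β⁻¹ • γ + e₂) = w + t • d := by rw [hw]; abel
    rw [e1, smul_eq_mul, smul_eq_mul] at h2
    rw [e2, norm_add_sq_real, inner_smul_right, norm_smul, mul_pow, Real.norm_eq_abs, sq_abs] at h1
    have h3 : g (yp + t • d) / β ≤ ((1 - t) * g yp + t * g y) / β := by gcongr
    have h4 : ((1 - t) * g yp + t * g y) / β = g yp / β + t * ((g y - g yp) / β) := by ring
    have h5 : 0 ≤ t * ((g y - g yp) / β + ⟪w, d⟫ + t / 2 * ‖d‖ ^ 2) := by nlinarith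
    exact nonneg_of_mul_nonneg_right h5 ht
  have hS : 0 ≤ (g y - g yp) / β + ⟪w, d⟫ := by
    by_contra! hneg
    set S := (g y - g yp) / β + ⟪w, d⟫
    have hD : 0 ≤ ‖d‖ ^ 2 := sq_nonneg _
    have hp : 0 < ‖d‖ ^ 2 - S := by linarith
    have h := key (-S / (‖d‖ ^ 2 - S)) (div_pos (by linarith) hp)
      ((div_le_one hp).2 (by linarith))
    have h' : (-S / (‖d‖ ^ 2 - S)) * (‖d‖ ^ 2 - S) = -S := by field_simp
    set t := -S / (‖d‖ ^ 2 - S)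
    have h6 := mul_nonneg h hp.le
    have h7 : (S + t / 2 * ‖d‖ ^ 2) * (‖d‖ ^ 2 - S)
        = S * (‖d‖ ^ 2 - S) + (t * (‖d‖ ^ 2 - S)) / 2 * ‖d‖ ^ 2 := by ring
    rw [h7, h'] at h6
    nlinarith
  have hwd : β * ⟪w, d⟫ = β * ⟪xp + yp, d⟫ + ⟪γ, d⟫ - β * ⟪e₂, d⟫ := by
    have : w = (xp + yp) + β⁻¹ • γ - e₂ := by rw [hw]; abel
    rw [this, inner_sub_left, inner_add_left, real_inner_smul_left]
    field_simp
  have hS2 : 0 ≤ g y - g yp + β * ⟪w, d⟫ := by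
    have := mul_nonneg hb.le hS
    rwa [mul_add, mul_div_cancel₀ _ hb.ne'] at this
  have hcs : -(‖e₂‖ * ‖d‖) ≤ ⟪e₂, d⟫ := by
    have := abs_real_inner_le_norm e₂ d
    exact (abs_le.1 this).1
  have hcs2 := mul_le_mul_of_nonneg_left hcs hb.le
  have hyoung : β * (‖e₂‖ * ‖d‖) ≤ (β - Lg) / 4 * ‖d‖ ^ 2 + β ^ 2 / (β - Lg) * ‖e₂‖ ^ 2 := by
    have h : (β - Lg) / 4 * ‖d‖ ^ 2 + β ^ 2 / (β - Lg) * ‖e₂‖ ^ 2 - β * (‖e₂‖ * ‖d‖)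
        = ((β - Lg) / 2 * ‖d‖ - β * ‖e₂‖) ^ 2 / (β - Lg) := by
      field_simp
      ring
    have : 0 ≤ ((β - Lg) / 2 * ‖d‖ - β * ‖e₂‖) ^ 2 / (β - Lg) := by positivity
    linarith
  have hn : ‖yp - y‖ = ‖d‖ := by rw [hd, norm_sub_rev]
  have hxy : xp + y = (xp + yp) + d := by rw [hy]; abel
  rw [hLb, hLb, hn, hxy, inner_add_right γ (xp + yp) d, norm_add_sq_real (xp + yp) d]
  have hD : 0 ≤ Lg * ‖d‖ ^ 2 := by positivity
  nlinarith
end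

section
/- Let E be a real inner product space, f : E → ℝ, g : E → ℝ convex and differentiable with L_g-Lipschitz gradient, α > 0, and β > (2√2 + 1)L_g. Define L_β(x, y, γ) := f(x) + g(y) + ⟨γ, x + y⟩ + (β/2)‖x + y‖². Let x, y, γ, e₂, e₁⁺, e₂⁺ ∈ E satisfy ∇g(y) = −γ + β·e₂ (stationarity from the previous iteration), and let one inexact ADMM iteration produce: x⁺ minimizing u ↦ f(u)/(α+β) + ‖u − ((α x − β y − γ)/(α+β) + e₁⁺)‖²/2, then y⁺ minimizing v ↦ g(v)/β + ‖v − (−x⁺ − γ/β + e₂⁺)‖²/2, then γ⁺ := γ + β(x⁺ + y⁺). Set ν := min{α/4, (β − L_g)/4 − 2L_g²/β} and ρ := max{(α+β)²/α, β²/(β − L_g), 2β}. Then ν > 0 and L_β(x, y, γ) − L_β(x⁺, y⁺, γ⁺) ≥ ν(‖x⁺ − x‖² + ‖y⁺ − y‖²) − ρ(‖e₂⁺ − e₂‖² + ‖e₁⁺‖² + ‖e₂⁺‖²). -/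
open Filter Topology RealInnerProductSpace

theorem aux_grad_ineq {E : Type*} [NormedAddCommGroup E] [InnerProductSpace ℝ E]
    (g : E → ℝ) (g' : E → E) (hgconv : ConvexOn ℝ Set.univ g)
    (hgdiff : ∀ u, HasFDerivAt g (innerSL ℝ (g' u)) u) (u v : E) :
    g u + ⟪g' u, v - u⟫ ≤ g v := by
  have hl : HasDerivAt (fun t : ℝ => u + t • (v - u)) (v - u) 0 := by
    simpa using ((hasDerivAt_id (0 : ℝ)).smul_const (v - u)).const_add u
  have hd : HasDerivAt (fun t : ℝ => g (u + t • (v - u))) ⟪g' u, v - u⟫ 0 := by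
    have h1 : HasFDerivAt g (innerSL ℝ (g' u)) (u + (0 : ℝ) • (v - u)) := by
      simpa using hgdiff u
    exact h1.comp_hasDerivAt (0 : ℝ) hl
  have hc : ConvexOn ℝ Set.univ (fun t : ℝ => g (u + t • (v - u))) := by
    refine ⟨convex_univ, ?_⟩
    intro s _ t _ a b ha hb hab
    have := hgconv.2 (Set.mem_univ (u + s • (v - u))) (Set.mem_univ (u + t • (v - u))) ha hb hab
    refine le_trans (le_of_eq ?_) this
    show g _ = g _
    congr 1
    have hu : u = (a + b) • u := by rw [hab, one_smul]
    conv_lhs => rw [hu]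
    simp only [smul_eq_mul]
    rw [← hu]
    conv_lhs => enter [1]; rw [hu]
    module
  have := hc.le_slope_of_hasDerivAt (Set.mem_univ (0 : ℝ)) (Set.mem_univ (1 : ℝ)) one_pos hd
  simp [slope_def_field] at this
  linarith

theorem aux_young {E : Type*} [NormedAddCommGroup E] [InnerProductSpace ℝ E]
    (b c : ℝ) (hc : 0 < c) (e d : E) :
    b * ⟪e, d⟫ ≤ c / 4 * ‖d‖ ^ 2 + b ^ 2 / c * ‖e‖ ^ 2 := by
  have h1 : 0 ≤ ‖(c / 2) • d - b • e‖ ^ 2 := by positivity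
  rw [norm_sub_sq_real, inner_smul_left, inner_smul_right, norm_smul, norm_smul, mul_pow, mul_pow,
    real_inner_comm] at h1
  simp only [Real.norm_eq_abs, sq_abs, conj_trivial] at h1
  have h2 : c / 4 * ‖d‖ ^ 2 + b ^ 2 / c * ‖e‖ ^ 2 - b * ⟪e, d⟫ =
      ((c / 2) ^ 2 * ‖d‖ ^ 2 - 2 * (c / 2 * (b * ⟪e, d⟫)) + b ^ 2 * ‖e‖ ^ 2) / c := by
    field_simp
    ring
  have h3 := div_nonneg h1 hc.le
  linarith

/-- Pseudo sufficient descent for one full iteration of the inexact nonconvex ADMM: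
    with ν = min{α/4, (β−L_g)/4 − 2L_g²/β} and ρ = max{(α+β)²/α, β²/(β−L_g), 2β},
    one has ν > 0 and
    L_β(x,y,γ) − L_β(x⁺,y⁺,γ⁺) ≥ ν(‖x⁺−x‖² + ‖y⁺−y‖²) − ρ(‖e₂⁺−e₂‖² + ‖e₁⁺‖² + ‖e₂⁺‖²). -/
theorem inexact_admm_full_descent {E : Type*} [NormedAddCommGroup E]
    [InnerProductSpace ℝ E]
    (f g : E → ℝ) (g' : E → E) (Lg α β : ℝ) (hLg : 0 < Lg) (hα : 0 < α)
    (hβ : (2 * Real.sqrt 2 + 1) * Lg < β)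
    (hgconv : ConvexOn ℝ Set.univ g)
    (hgdiff : ∀ u, HasFDerivAt g (innerSL ℝ (g' u)) u)
    (hglip : ∀ u v, ‖g' u - g' v‖ ≤ Lg * ‖u - v‖)
    (Lb : E → E → E → ℝ)
    (hLb : ∀ x y γ, Lb x y γ = f x + g y + ⟪γ, x + y⟫ + (β / 2) * ‖x + y‖ ^ 2)
    (x y γ e₂ e₁p e₂p xp yp γp : E)
    (hstat : g' y = -γ + β • e₂)
    (hminx : ∀ u,
      f xp / (α + β) + ‖xp - ((α + β)⁻¹ • (α • x - β • y - γ) + e₁p)‖ ^ 2 / 2 ≤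
        f u / (α + β) + ‖u - ((α + β)⁻¹ • (α • x - β • y - γ) + e₁p)‖ ^ 2 / 2)
    (hminy : ∀ v, g yp / β + ‖yp - (-xp - β⁻¹ • γ + e₂p)‖ ^ 2 / 2 ≤
                  g v / β + ‖v - (-xp - β⁻¹ • γ + e₂p)‖ ^ 2 / 2)
    (hγp : γp = γ + β • (xp + yp))
    (ν ρ : ℝ)
    (hν : ν = min (α / 4) ((β - Lg) / 4 - 2 * Lg ^ 2 / β))
    (hρ : ρ = max ((α + β) ^ 2 / α) (max (β ^ 2 / (β - Lg)) (2 * β))) :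
    0 < ν ∧
      Lb x y γ - Lb xp yp γp ≥
        ν * (‖xp - x‖ ^ 2 + ‖yp - y‖ ^ 2) -
          ρ * (‖e₂p - e₂‖ ^ 2 + ‖e₁p‖ ^ 2 + ‖e₂p‖ ^ 2) := by
  have hs2 : (1 : ℝ) < Real.sqrt 2 := by
    rw [Real.lt_sqrt] <;> norm_num
  have hs2' : Real.sqrt 2 ^ 2 = 2 := Real.sq_sqrt (by norm_num)
  have hsL : Lg < Real.sqrt 2 * Lg := by nlinarith
  have hβL : 3 * Lg < β := by nlinarith
  have hβ0 : 0 < β := by linarith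
  have hβL0 : 0 < β - Lg := by linarith
  have hαβ : 0 < α + β := by linarith
  have hν2 : 0 < (β - Lg) / 4 - 2 * Lg ^ 2 / β := by
    have h1 : 8 * Lg ^ 2 < (β - Lg) * β := by
      have h2 : 2 * (Real.sqrt 2 * Lg) < β - Lg := by linarith
      have h3 : 2 * (Real.sqrt 2 * Lg) < β := by linarith
      have h4 : 0 < 2 * (Real.sqrt 2 * Lg) := by positivity
      have h5 := mul_lt_mul'' h2 h3 h4.le h4.le
      have h6 : 2 * (Real.sqrt 2 * Lg) * (2 * (Real.sqrt 2 * Lg)) = 8 * Lg ^ 2 := by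
        linear_combination 4 * Lg ^ 2 * hs2'
      linarith
    have : (β - Lg) / 4 - 2 * Lg ^ 2 / β = ((β - Lg) * β - 8 * Lg ^ 2) / (4 * β) := by
      field_simp
      ring
    rw [this]
    apply div_pos <;> linarith
  have hν0 : 0 < ν := by rw [hν]; exact lt_min (by linarith) hν2
  refine ⟨hν0, ?_⟩
  -- first-order condition for y
  have hfoc : g' yp = -γp + β • e₂p := by
    set c := -xp - β⁻¹ • γ + e₂p with hc
    have hF : HasFDerivAt (fun v => g v + β / 2 * ‖v - c‖ ^ 2)
        (innerSL ℝ (g' yp) + (β / 2) • (2 • (innerSL ℝ (yp - c)).comp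
          (ContinuousLinearMap.id ℝ E))) yp := by
      exact (hgdiff yp).add ((((hasFDerivAt_id yp).sub_const c).norm_sq).const_mul (β / 2))
    have hmin : IsLocalMin (fun v => g v + β / 2 * ‖v - c‖ ^ 2) yp := by
      refine Filter.Eventually.of_forall fun v => ?_
      have h1 := mul_le_mul_of_nonneg_left (hminy v) hβ0.le
      have h2 : ∀ a b : ℝ, β * (a / β + b / 2) = a + β / 2 * b := by
        intro a b
        field_simp
      rw [h2, h2] at h1
      exact h1
    have h0 := hmin.hasFDerivAt_eq_zero hF
    have h1 : g' yp + β • (yp - c) = 0 := by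
      apply ext_inner_right ℝ
      intro w
      have h2 := congrArg (fun T : E →L[ℝ] ℝ => T w) h0
      simp at h2
      rw [inner_add_left, inner_smul_left, inner_zero_left]
      simp only [conj_trivial]
      rw [inner_sub_left]
      linarith
    have h3 : g' yp = -(β • (yp - c)) := eq_neg_of_add_eq_zero_left h1
    rw [h3, hγp, hc]
    have : β • (β⁻¹ • γ) = γ := smul_inv_smul₀ hβ0.ne' γ
    simp only [smul_sub, smul_add, smul_neg, this]
    abel
  -- x step
  have hx : f xp + ⟪γ, xp⟫ + β / 2 * ‖xp + y‖ ^ 2 + α / 2 * ‖xp - x‖ ^ 2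
      - (α + β) * ⟪e₁p, xp - x⟫ ≤ f x + ⟪γ, x⟫ + β / 2 * ‖x + y‖ ^ 2 := by
    have h1 := mul_le_mul_of_nonneg_left (hminx x) hαβ.le
    have h2 : ∀ a b : ℝ, (α + β) * (a / (α + β) + b / 2) = a + (α + β) / 2 * b := by
      intro a b
      field_simp
    rw [h2, h2] at h1
    set c := (α + β)⁻¹ • (α • x - β • y - γ) + e₁p with hc
    have h3 : ∀ u, (α + β) * ⟪u, c⟫ = α * ⟪u, x⟫ - β * ⟪u, y⟫ - ⟪γ, u⟫ + (α + β) * ⟪e₁p, u⟫ := by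
      intro u
      have : (α + β) • c = α • x - β • y - γ + (α + β) • e₁p := by
        rw [hc, smul_add, smul_inv_smul₀ hαβ.ne']
      rw [← inner_smul_right, this]
      simp only [inner_add_right, inner_sub_right, inner_smul_right]
      rw [real_inner_comm γ u, real_inner_comm e₁p u]
    have h4 := h3 x
    have h5 := h3 xp
    rw [real_inner_self_eq_norm_sq] at h4
    simp only [norm_sub_sq_real, norm_add_sq_real, inner_sub_right] at h1 ⊢
    linarith
  have hxy := aux_young (α + β) α hα e₁p (xp - x)
  -- y step
  have hgy := aux_grad_ineq g g' hgconv hgdiff yp y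
  have hyy := aux_young β (β - Lg) hβL0 e₂p (yp - y)
  have hy : g yp + ⟪γ, yp⟫ + β / 2 * ‖xp + yp‖ ^ 2 + β / 2 * ‖yp - y‖ ^ 2
      - β * ⟪e₂p, yp - y⟫ ≤ g y + ⟪γ, y⟫ + β / 2 * ‖xp + y‖ ^ 2 := by
    rw [hfoc, hγp] at hgy
    simp only [norm_sub_sq_real, norm_add_sq_real, inner_sub_right, inner_add_left, inner_neg_left,
      inner_smul_left, conj_trivial, real_inner_self_eq_norm_sq] at hgy ⊢
    linarith
  -- dual step
  have hd : β * ‖xp + yp‖ ^ 2 ≤ 2 * β * ‖e₂p - e₂‖ ^ 2 + 2 * Lg ^ 2 / β * ‖yp - y‖ ^ 2 := by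
    have h1 : β • (xp + yp) = β • (e₂p - e₂) - (g' yp - g' y) := by
      rw [hfoc, hstat, hγp, smul_sub]
      abel
    have h2 : β * ‖xp + yp‖ ≤ β * ‖e₂p - e₂‖ + Lg * ‖yp - y‖ := by
      have h3 := norm_sub_le (β • (e₂p - e₂)) (g' yp - g' y)
      rw [← h1, norm_smul, norm_smul, Real.norm_of_nonneg hβ0.le] at h3
      linarith [hglip yp y]
    have h4 : (β * ‖xp + yp‖) ^ 2 ≤ 2 * (β * ‖e₂p - e₂‖) ^ 2 + 2 * (Lg * ‖yp - y‖) ^ 2 := by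
      have := pow_le_pow_left₀ (by positivity) h2 2
      nlinarith [sq_nonneg (β * ‖e₂p - e₂‖ - Lg * ‖yp - y‖)]
    have h5 := div_le_div_of_nonneg_right h4 hβ0.le
    have e1 : (β * ‖xp + yp‖) ^ 2 / β = β * ‖xp + yp‖ ^ 2 := by field_simp
    have e2 : (2 * (β * ‖e₂p - e₂‖) ^ 2 + 2 * (Lg * ‖yp - y‖) ^ 2) / β =
        2 * β * ‖e₂p - e₂‖ ^ 2 + 2 * Lg ^ 2 / β * ‖yp - y‖ ^ 2 := by field_simp
    rwa [e1, e2] at h5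
  have hν1 : ν ≤ α / 4 := hν ▸ min_le_left _ _
  have hν2' : ν ≤ (β - Lg) / 4 - 2 * Lg ^ 2 / β := hν ▸ min_le_right _ _
  have hρ1 : (α + β) ^ 2 / α ≤ ρ := hρ ▸ le_max_left _ _
  have hρ2 : β ^ 2 / (β - Lg) ≤ ρ := hρ ▸ (le_max_left _ _).trans (le_max_right _ _)
  have hρ3 : 2 * β ≤ ρ := hρ ▸ (le_max_right _ _).trans (le_max_right _ _)
  have m1 := mul_le_mul_of_nonneg_right hν1 (sq_nonneg ‖xp - x‖)
  have m2 := mul_le_mul_of_nonneg_right hν2' (sq_nonneg ‖yp - y‖)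
  have m3 := mul_le_mul_of_nonneg_right hρ1 (sq_nonneg ‖e₁p‖)
  have m4 := mul_le_mul_of_nonneg_right hρ2 (sq_nonneg ‖e₂p‖)
  have m5 := mul_le_mul_of_nonneg_right hρ3 (sq_nonneg ‖e₂p - e₂‖)
  have m6 : 0 ≤ Lg * ‖yp - y‖ ^ 2 := by positivity
  rw [hLb, hLb, hγp, inner_add_left, inner_smul_left, real_inner_self_eq_norm_sq,
    inner_add_right, inner_add_right]
  simp only [conj_trivial]
  linarith
end
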